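/- Suppose F is a real-valued function on the class of bounded transfinite sequences of reals of nonzero length satisfying: (1) F(s) = s_(0) whenever ℓ(s) = 1; (2) F(s ⊕ r) = F(r ⊕ s) for all bounded r, s of nonzero length; (3) F(s₀ ⊕ ⋯ ⊕ s_{n−1}) = (1/n)(F(s₀) + ⋯ + F(s_{n−1})) whenever s₀, …, s_{n−1} are bounded sequences of equal nonzero length; and (4) F(s) = limsup_{ξ → ℓ(s)} F(s|_ξ) whenever ℓ(s) is indecomposable and greater than 1. Then F(s) = M̄(s) for every bounded transfinite sequence s of reals of nonzero length. -/

import Mathlib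

open Ordinal

/-- The number `n` of full blocks in the standard decomposition `o = ω^σ·n + ρ`,
where `ω^σ = ω ^ log ω o` is the largest indecomposable ordinal `≤ o`. -/
noncomputable def stdBlocks (o : Ordinal.{0}) : ℕ :=
  Cardinal.toNat (o / omega0 ^ log omega0 o).card

/-- The upper mean `M̄` of a transfinite sequence of reals.  A sequence of length `o`
is encoded as a total function `f : Ordinal → ℝ`; only the values of `f` at ordinals
`< o` are ever used.  It is defined by transfinite recursion on `o`:
(1) for `o = 1` it is `f 0`;
(2) for `o` indecomposable with `o > 1` (i.e. `o = ω^σ` with `σ > 0`) it is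
    `limsup_{ξ → o} M̄(f|_ξ) = inf_{1 ≤ ζ < o} sup_{ζ ≤ ξ < o} M̄(f|_ξ)`;
(3) for decomposable `o`, writing `o = ω^σ·n + ρ` with `ρ < ω^σ`, it is the average
    `(1/n) (M̄(s₀) + ⋯ + M̄(s_{n-1}))` of the upper means of the `n` consecutive
    blocks of `f` of length `ω^σ` (the remainder of length `ρ` is discarded). -/
noncomputable def upperMean (o : Ordinal.{0}) (f : Ordinal.{0} → ℝ) : ℝ :=
  if o = 1 then f 0
  else if h1 : 1 < o ∧ o = omega0 ^ log omega0 o then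
    ⨅ ζ : Set.Ico (1 : Ordinal.{0}) o, ⨆ ξ : Set.Ico ζ.1 o, upperMean ξ.1 f
  else if h2 : 1 < o then
    ((stdBlocks o : ℝ))⁻¹ *
      ∑ i ∈ Finset.range (stdBlocks o),
        upperMean (omega0 ^ log omega0 o)
          (fun ξ => f (omega0 ^ log omega0 o * (i : Ordinal) + ξ))
  else 0
termination_by o
decreasing_by
  · exact ξ.2.2
  · exact lt_of_le_of_ne (opow_log_le_self _ (zero_lt_one.trans h2).ne')
      fun h => h1 ⟨h2, h.symm⟩

/-- A transfinite sequence of reals of length `o` is bounded if its range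
(on indices `< o`) is bounded in `ℝ`. -/
def SeqBounded (o : Ordinal.{0}) (f : Ordinal.{0} → ℝ) : Prop :=
  ∃ C : ℝ, ∀ ξ < o, |f ξ| ≤ C

/-- The concatenation `r ⊕ s` of a sequence `r` of length `a` with a sequence `s`:
its first `a` entries are those of `r`, and its entry at `a + ξ'` is `s ξ'`. -/
noncomputable def concatSeq (a : Ordinal.{0}) (r s : Ordinal.{0} → ℝ) :
    Ordinal.{0} → ℝ :=
  fun ξ => if ξ < a then r ξ else s (ξ - a)

/-- An ordinal is indecomposable if it is nonzero and not the sum of two strictly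
smaller ordinals. -/
def IsIndecomposable (o : Ordinal.{0}) : Prop :=
  o ≠ 0 ∧ ∀ b < o, ∀ c < o, b + c ≠ o

/-- The concatenation `s₀ ⊕ s₁ ⊕ ⋯ ⊕ s_{n-1}` of `n` sequences, each of length `β`;
the result has length `β * n`. -/
noncomputable def concatN (β : Ordinal.{0}) :
    (n : ℕ) → (Fin n → Ordinal.{0} → ℝ) → Ordinal.{0} → ℝ
  | 0, _ => fun _ => 0
  | n + 1, s => concatSeq (β * n) (concatN β n (fun i => s i.castSucc)) (s (Fin.last n))

/-- `s / β`: given a sequence `s` whose length is `β * α`, the sequence of length `α`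
whose `ι`-th entry is the upper mean of the `ι`-th consecutive block of `s` of
length `β`. -/
noncomputable def seqDiv (s : Ordinal.{0} → ℝ) (β : Ordinal.{0}) : Ordinal.{0} → ℝ :=
  fun ι => upperMean β (fun ξ => s (β * ι + ξ))

/-- The lower mean `𝕄̲(s) = -M̄(-s)`. -/
noncomputable def lowerMean (o : Ordinal.{0}) (s : Ordinal.{0} → ℝ) : ℝ :=
  - upperMean o (fun ξ => - s ξ)

/-- A sequence `s` of length `o` has mean `c` when its upper and lower means both
equal `c`. -/
def HasMean (o : Ordinal.{0}) (s : Ordinal.{0} → ℝ) (c : ℝ) : Prop :=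
  upperMean o s = c ∧ lowerMean o s = c

theorem exists_eq_omega0_opow_log_mul_add {o : Ordinal.{0}} (ho : o ≠ 0) :
    ∃ (n : ℕ) (ρ : Ordinal.{0}), 1 ≤ n ∧ ρ < ω ^ log ω o ∧ o = ω ^ log ω o * n + ρ := by
  obtain ⟨n, hn⟩ := lt_omega0.1 (div_opow_log_lt o one_lt_omega0)
  have hpos := div_opow_log_pos ω ho
  rw [hn] at hpos
  refine ⟨n, o % ω ^ log ω o, by exact_mod_cast hpos,
    mod_lt _ (opow_ne_zero _ omega0_ne_zero), ?_⟩
  rw [← hn, div_add_mod]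

theorem log_omega0_opow_mul_natCast_add {τ ρ : Ordinal.{0}} {n : ℕ} (hn : 1 ≤ n)
    (hρ : ρ < ω ^ τ) : log ω (ω ^ τ * n + ρ) = τ := by
  rw [log_opow_mul_add one_lt_omega0 (by exact_mod_cast (by omega : n ≠ 0)) hρ,
    log_eq_zero (natCast_lt_omega0 n), add_zero]

theorem stdBlocks_omega0_opow_mul_natCast_add {τ ρ : Ordinal.{0}} {n : ℕ} (hn : 1 ≤ n)
    (hρ : ρ < ω ^ τ) : stdBlocks (ω ^ τ * n + ρ) = n := by
  rw [stdBlocks, log_omega0_opow_mul_natCast_add hn hρ,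
    mul_add_div _ (opow_ne_zero _ omega0_ne_zero), div_eq_zero_of_lt hρ, add_zero, card_nat,
    Cardinal.toNat_natCast]

theorem omega0_opow_le_mul_natCast_add {n : ℕ} (hn : 1 ≤ n) (τ ρ : Ordinal.{0}) :
    ω ^ τ ≤ ω ^ τ * n + ρ := by
  refine le_trans ?_ le_self_add
  exact le_mul_left _ (by exact_mod_cast hn)

theorem mul_natCast_add_lt {β ξ : Ordinal.{0}} {i n : ℕ} (hi : i < n) (hξ : ξ < β) :
    β * i + ξ < β * n := by
  calc β * i + ξ < β * i + β := by gcongr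
    _ = β * (i + 1 : ℕ) := by rw [Nat.cast_add_one, mul_add_one]
    _ ≤ β * n := by gcongr; exact hi

theorem one_lt_omega0_opow {σ : Ordinal.{0}} (hσ : σ ≠ 0) : 1 < ω ^ σ := by
  simpa using (opow_lt_opow_iff_right one_lt_omega0).2 (pos_iff_ne_zero.2 hσ)

theorem isIndecomposable_omega0_opow (σ : Ordinal.{0}) : IsIndecomposable (ω ^ σ) :=
  ⟨opow_ne_zero _ omega0_ne_zero,
    fun _ hb _ hc => (isPrincipal_add_omega0_opow σ hb hc).ne⟩

/-- The block formula for the upper mean holds for every length `ω ^ τ * n + ρ`,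
indecomposable lengths included. -/
theorem upperMean_mul_natCast_add {τ ρ : Ordinal.{0}} {n : ℕ} (hn : 1 ≤ n) (hρ : ρ < ω ^ τ)
    (f : Ordinal.{0} → ℝ) :
    upperMean (ω ^ τ * n + ρ) f =
      (n : ℝ)⁻¹ * ∑ i ∈ Finset.range n, upperMean (ω ^ τ) (fun ξ => f (ω ^ τ * i + ξ)) := by
  by_cases h : ω ^ τ * n + ρ = ω ^ τ
  · obtain rfl : n = 1 := by
      by_contra h1
      have h2 := mul_natCast_add_lt (i := 1) (n := n) (by omega) (opow_pos τ omega0_pos)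
      rw [Nat.cast_one, mul_one, add_zero] at h2
      exact (h2.trans_le le_self_add).ne' h
    rw [h]
    simp
  · have hlt : ω ^ τ < ω ^ τ * n + ρ :=
      (omega0_opow_le_mul_natCast_add hn τ ρ).lt_of_ne (Ne.symm h)
    have h1 : 1 < ω ^ τ * n + ρ :=
      (Order.one_le_iff_pos.2 (opow_pos τ omega0_pos)).trans_lt hlt
    rw [upperMean, if_neg h1.ne', dif_neg, dif_pos h1,
      stdBlocks_omega0_opow_mul_natCast_add hn hρ, log_omega0_opow_mul_natCast_add hn hρ]
    rw [log_omega0_opow_mul_natCast_add hn hρ]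
    exact fun h2 => h h2.2

theorem upperMean_omega0_opow {σ : Ordinal.{0}} (hσ : σ ≠ 0) (f : Ordinal.{0} → ℝ) :
    upperMean (ω ^ σ) f =
      ⨅ ζ : Set.Ico (1 : Ordinal.{0}) (ω ^ σ), ⨆ ξ : Set.Ico ζ.1 (ω ^ σ), upperMean ξ.1 f := by
  have h1 := one_lt_omega0_opow hσ
  rw [upperMean, if_neg h1.ne', dif_pos]
  exact ⟨h1, by rw [log_opow one_lt_omega0]⟩

theorem upperMean_one (f : Ordinal.{0} → ℝ) : upperMean 1 f = f 0 := by
  rw [upperMean, if_pos rfl]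

section LimsupBounds

variable {o : Ordinal.{0}} {C : ℝ} {g h : Ordinal.{0} → ℝ}

theorem bddAbove_range_of_abs_le (hg : ∀ ξ, 1 ≤ ξ → ξ < o → |g ξ| ≤ C)
    (ζ : Set.Ico (1 : Ordinal.{0}) o) :
    BddAbove (Set.range fun ξ : Set.Ico ζ.1 o => g ξ.1) := by
  refine ⟨C, ?_⟩
  rintro _ ⟨ξ, rfl⟩
  exact (abs_le.1 (hg ξ.1 (ζ.2.1.trans ξ.2.1) ξ.2.2)).2

theorem abs_iSup_Ico_le (hg : ∀ ξ, 1 ≤ ξ → ξ < o → |g ξ| ≤ C)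
    (ζ : Set.Ico (1 : Ordinal.{0}) o) : |⨆ ξ : Set.Ico ζ.1 o, g ξ.1| ≤ C := by
  have : Nonempty (Set.Ico ζ.1 o) := ⟨⟨ζ.1, le_rfl, ζ.2.2⟩⟩
  refine abs_le.2 ⟨?_, ciSup_le fun ξ => (abs_le.1 (hg ξ.1 (ζ.2.1.trans ξ.2.1) ξ.2.2)).2⟩
  exact le_ciSup_of_le (bddAbove_range_of_abs_le hg ζ) ⟨ζ.1, le_rfl, ζ.2.2⟩
    (abs_le.1 (hg ζ.1 ζ.2.1 ζ.2.2)).1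

theorem bddBelow_range_iSup_Ico (hg : ∀ ξ, 1 ≤ ξ → ξ < o → |g ξ| ≤ C) :
    BddBelow (Set.range fun ζ : Set.Ico (1 : Ordinal.{0}) o => ⨆ ξ : Set.Ico ζ.1 o, g ξ.1) := by
  refine ⟨-C, ?_⟩
  rintro _ ⟨ζ, rfl⟩
  exact (abs_le.1 (abs_iSup_Ico_le hg ζ)).1

theorem abs_iInf_iSup_Ico_le (ho : 1 < o) (hg : ∀ ξ, 1 ≤ ξ → ξ < o → |g ξ| ≤ C) :
    |⨅ ζ : Set.Ico (1 : Ordinal.{0}) o, ⨆ ξ : Set.Ico ζ.1 o, g ξ.1| ≤ C := by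
  have : Nonempty (Set.Ico (1 : Ordinal.{0}) o) := ⟨⟨1, le_rfl, ho⟩⟩
  refine abs_le.2 ⟨le_ciInf fun ζ => (abs_le.1 (abs_iSup_Ico_le hg ζ)).1, ?_⟩
  exact ciInf_le_of_le (bddBelow_range_iSup_Ico hg) ⟨1, le_rfl, ho⟩
    (abs_le.1 (abs_iSup_Ico_le hg _)).2

theorem iInf_iSup_Ico_le_of_eventually_le (ho : 1 < o)
    (hg : ∀ ξ, 1 ≤ ξ → ξ < o → |g ξ| ≤ C) (hh : ∀ ξ, 1 ≤ ξ → ξ < o → |h ξ| ≤ C)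
    (hgh : ∀ ε > 0, ∃ ζ < o, ∀ ξ, ζ ≤ ξ → 1 ≤ ξ → ξ < o → g ξ ≤ h ξ + ε) :
    (⨅ ζ : Set.Ico (1 : Ordinal.{0}) o, ⨆ ξ : Set.Ico ζ.1 o, g ξ.1) ≤
      ⨅ ζ : Set.Ico (1 : Ordinal.{0}) o, ⨆ ξ : Set.Ico ζ.1 o, h ξ.1 := by
  have : Nonempty (Set.Ico (1 : Ordinal.{0}) o) := ⟨⟨1, le_rfl, ho⟩⟩
  refine le_ciInf fun ζ => le_of_forall_pos_le_add fun ε hε => ?_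
  obtain ⟨ζ₀, hζ₀, hle⟩ := hgh ε hε
  let ζ' : Set.Ico (1 : Ordinal.{0}) o :=
    ⟨max ζ.1 ζ₀, ζ.2.1.trans (le_max_left _ _), max_lt ζ.2.2 hζ₀⟩
  have : Nonempty (Set.Ico ζ'.1 o) := ⟨⟨ζ'.1, le_rfl, ζ'.2.2⟩⟩
  refine ciInf_le_of_le (bddBelow_range_iSup_Ico hg) ζ' (ciSup_le fun ξ => ?_)
  have hζξ : ζ.1 ≤ ξ.1 := (le_max_left _ _).trans ξ.2.1
  refine (hle ξ.1 ((le_max_right _ _).trans ξ.2.1) (ζ.2.1.trans hζξ) ξ.2.2).trans ?_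
  gcongr
  exact le_ciSup (bddAbove_range_of_abs_le hh ζ) ⟨ξ.1, hζξ, ξ.2.2⟩

end LimsupBounds

theorem abs_upperMean_le {C : ℝ} (o : Ordinal.{0}) (ho : o ≠ 0) (f : Ordinal.{0} → ℝ)
    (hf : ∀ ξ < o, |f ξ| ≤ C) : |upperMean o f| ≤ C := by
  induction o using WellFoundedLT.induction generalizing f with
  | ind o ih =>
  obtain ⟨n, ρ, hn, hρ, hoeq⟩ := exists_eq_omega0_opow_log_mul_add ho
  generalize log ω o = τ at hρ hoeq
  obtain hlt | heq := (omega0_opow_le_mul_natCast_add hn τ ρ).lt_or_eq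
  · rw [hoeq, upperMean_mul_natCast_add hn hρ]
    have hn0 : (0 : ℝ) < n := by exact_mod_cast hn
    rw [abs_mul, abs_inv, abs_of_pos hn0, inv_mul_le_iff₀ hn0]
    refine (Finset.abs_sum_le_sum_abs _ _).trans ?_
    refine (Finset.sum_le_card_nsmul _ _ C fun i hi => ?_).trans (by simp)
    refine ih _ (hoeq ▸ hlt) (opow_ne_zero _ omega0_ne_zero) _ fun ξ hξ => hf _ ?_
    rw [hoeq]
    exact (mul_natCast_add_lt (Finset.mem_range.1 hi) hξ).trans_le le_self_add
  · obtain rfl : o = ω ^ τ := hoeq.trans heq.symm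
    obtain rfl | hτ := eq_or_ne τ 0
    · rw [opow_zero, upperMean_one]
      exact hf 0 (by simp)
    · rw [upperMean_omega0_opow hτ]
      exact abs_iInf_iSup_Ico_le (g := fun ξ => upperMean ξ f) (one_lt_omega0_opow hτ)
        fun ξ h1 hξ =>
        ih ξ hξ (Order.one_le_iff_pos.1 h1).ne' f fun η hη => hf η (hη.trans hξ)

theorem abs_concatSeq_le {C : ℝ} {a o : Ordinal.{0}} {r s : Ordinal.{0} → ℝ}
    (hr : ∀ ξ < a, |r ξ| ≤ C) (hs : ∀ ξ < o, |s ξ| ≤ C) :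
    ∀ ξ < o, |concatSeq a r s ξ| ≤ C := by
  intro ξ hξ
  rw [concatSeq]
  split_ifs with h
  · exact hr ξ h
  · exact hs _ ((Ordinal.sub_le_self ξ a).trans_lt hξ)

theorem concatSeq_add (a c : Ordinal.{0}) (r s : Ordinal.{0} → ℝ) :
    (fun ξ => concatSeq (a + c) r s (a + ξ)) = concatSeq c (fun ξ => r (a + ξ)) s := by
  funext ξ
  simp only [concatSeq, add_lt_add_iff_left, Ordinal.add_sub_add_cancel]

theorem concatSeq_omega0_opow_mul {τ a : Ordinal.{0}} (ha : a < ω ^ τ) {i : ℕ} (hi : 1 ≤ i)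
    (r s : Ordinal.{0} → ℝ) :
    (fun ξ => concatSeq a r s (ω ^ τ * i + ξ)) = fun ξ => s (ω ^ τ * i + ξ) := by
  funext ξ
  have hle := omega0_opow_le_mul_natCast_add hi τ ξ
  rw [concatSeq, if_neg (ha.trans_le hle).not_gt]
  nth_rewrite 1 [← add_of_omega0_opow_le ha hle]
  rw [Ordinal.add_sub_cancel]

/-- Prepending a sequence with `m` full blocks of length `ω ^ τ` changes the upper mean of
a sequence with `n` such blocks by at most `2mC/n`. -/
theorem abs_upperMean_concatSeq_sub_le {τ a ρ : Ordinal.{0}} {m n : ℕ} {C : ℝ}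
    {r s : Ordinal.{0} → ℝ}
    (ih : ∀ a < ω ^ τ, ∀ r s : Ordinal.{0} → ℝ, (∀ ξ < a, |r ξ| ≤ C) →
      (∀ ξ < ω ^ τ, |s ξ| ≤ C) → upperMean (ω ^ τ) (concatSeq a r s) = upperMean (ω ^ τ) s)
    (hn : 1 ≤ n) (hρ : ρ < ω ^ τ) (ha : a < ω ^ τ) (hr : ∀ ξ < ω ^ τ * m + a, |r ξ| ≤ C)
    (hs : ∀ ξ < ω ^ τ * n + ρ, |s ξ| ≤ C) :
    |upperMean (ω ^ τ * n + ρ) (concatSeq (ω ^ τ * m + a) r s) - upperMean (ω ^ τ * n + ρ) s|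
      ≤ 2 * m * C / n := by
  have hne : ω ^ τ ≠ 0 := opow_ne_zero _ omega0_ne_zero
  have hone : ω ^ τ * n + ρ ≠ 0 :=
    ((pos_iff_ne_zero.2 hne).trans_le (omega0_opow_le_mul_natCast_add hn τ ρ)).ne'
  have hn0 : (0 : ℝ) < n := by exact_mod_cast hn
  have hc := abs_concatSeq_le hr hs
  have hC : 0 ≤ C := (abs_nonneg _).trans (hs 0 (pos_iff_ne_zero.2 hone))
  obtain hnm | hmn := le_total n m
  · have h1 := abs_le.1 (abs_upperMean_le _ hone _ hc)
    have h2 := abs_le.1 (abs_upperMean_le _ hone _ hs)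
    have h3 : 2 * C ≤ 2 * m * C / n := by
      rw [le_div_iff₀ hn0]
      have : (n : ℝ) ≤ m := by exact_mod_cast hnm
      nlinarith
    refine le_trans (abs_le.2 ⟨?_, ?_⟩) h3 <;> linarith
  obtain ⟨p, rfl⟩ := Nat.exists_eq_add_of_le hmn
  rw [upperMean_mul_natCast_add hn hρ, upperMean_mul_natCast_add hn hρ]
  have hblock : ∀ f : Ordinal.{0} → ℝ, (∀ ξ < ω ^ τ * (m + p : ℕ) + ρ, |f ξ| ≤ C) →
      ∀ i < m + p, |upperMean (ω ^ τ) (fun ξ => f (ω ^ τ * i + ξ))| ≤ C := fun f hf i hi =>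
    abs_upperMean_le _ hne _ fun ξ hξ => hf _ ((mul_natCast_add_lt hi hξ).trans_le le_self_add)
  have hshift : ∀ j < p,
      upperMean (ω ^ τ) (fun ξ => concatSeq (ω ^ τ * m + a) r s (ω ^ τ * (m + j : ℕ) + ξ)) =
        upperMean (ω ^ τ) (fun ξ => s (ω ^ τ * j + ξ)) := by
    intro j hj
    have h0 : (fun ξ => concatSeq (ω ^ τ * m + a) r s (ω ^ τ * (m + j : ℕ) + ξ)) =
        fun ξ => concatSeq a (fun ξ => r (ω ^ τ * m + ξ)) s (ω ^ τ * j + ξ) := by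
      rw [← concatSeq_add]
      funext ξ
      rw [Nat.cast_add, mul_add, add_assoc]
    rw [h0]
    obtain rfl | hj0 := Nat.eq_zero_or_pos j
    · simp only [Nat.cast_zero, mul_zero, zero_add]
      refine ih a ha _ _ (fun ξ hξ => hr _ (by gcongr)) fun ξ hξ => hs ξ ?_
      exact hξ.trans_le (omega0_opow_le_mul_natCast_add hn τ ρ)
    · rw [concatSeq_omega0_opow_mul ha hj0]
  rw [Finset.sum_range_add, Finset.sum_congr rfl fun j hj => hshift j (Finset.mem_range.1 hj),
    add_comm m p, Finset.sum_range_add,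
    add_comm (∑ i ∈ Finset.range m, _) (∑ j ∈ Finset.range p, _), ← _root_.mul_sub,
    add_sub_add_left_eq_sub, abs_mul, abs_inv, Nat.abs_cast, add_comm p m, inv_mul_eq_div]
  gcongr
  rw [← Finset.sum_sub_distrib]
  refine (Finset.abs_sum_le_sum_abs _ _).trans ?_
  refine (Finset.sum_le_card_nsmul _ _ (2 * C) fun i hi => ?_).trans
    (by rw [Finset.card_range, _root_.nsmul_eq_mul]; linarith)
  have hi := Finset.mem_range.1 hi
  have h1 := abs_le.1 (hblock _ hc i (by omega))
  have h2 := abs_le.1 (hblock _ hs (p + i) (by omega))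
  exact abs_le.2 ⟨by linarith, by linarith⟩

/-- Prepending a sequence of length less than `ω ^ σ` does not change the upper mean of a
sequence of length `ω ^ σ`. -/
theorem upperMean_omega0_opow_concatSeq {C : ℝ} (σ : Ordinal.{0}) :
    ∀ a < ω ^ σ, ∀ r s : Ordinal.{0} → ℝ, (∀ ξ < a, |r ξ| ≤ C) →
      (∀ ξ < ω ^ σ, |s ξ| ≤ C) → upperMean (ω ^ σ) (concatSeq a r s) = upperMean (ω ^ σ) s := by
  induction σ using WellFoundedLT.induction with
  | ind σ ih =>
  intro a ha r s hr hs
  obtain rfl | hσ := eq_or_ne σ 0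
  · rw [opow_zero, Order.lt_one_iff] at ha
    subst ha
    congr 1
    funext ξ
    simp [concatSeq]
  have h1 := one_lt_omega0_opow hσ
  have hc := abs_concatSeq_le hr hs
  have hb : ∀ f : Ordinal.{0} → ℝ, (∀ ξ < ω ^ σ, |f ξ| ≤ C) →
      ∀ ξ, 1 ≤ ξ → ξ < ω ^ σ → |upperMean ξ f| ≤ C := fun f hf ξ hξ1 hξ =>
    abs_upperMean_le ξ (Order.one_le_iff_pos.1 hξ1).ne' f fun η hη => hf η (hη.trans hξ)
  have key : ∀ ε > 0, ∃ ζ < ω ^ σ, ∀ ξ, ζ ≤ ξ → 1 ≤ ξ → ξ < ω ^ σ →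
      |upperMean ξ (concatSeq a r s) - upperMean ξ s| ≤ ε := by
    intro ε hε
    have hC : 0 ≤ C := (abs_nonneg _).trans (hs 0 (zero_lt_one.trans h1))
    -- `a` has `M` full blocks of the leading block length of `ξ`, and `ξ` has at least `N`
    obtain ⟨M, N, ζ, hζ, hdec⟩ : ∃ (M N : ℕ) (ζ : Ordinal.{0}), ζ < ω ^ σ ∧
        2 * M * C ≤ ε * N ∧ ∀ ξ, ζ ≤ ξ → 1 ≤ ξ → ξ < ω ^ σ → ∃ a', a' < ω ^ log ω ξ ∧
          a = ω ^ log ω ξ * M + a' ∧ ω ^ log ω ξ * N ≤ ξ := by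
      by_cases hsucc : ∃ τ, σ = Order.succ τ
      · obtain ⟨τ, rfl⟩ := hsucc
        have hτ : ω ^ τ ≠ 0 := opow_ne_zero _ omega0_ne_zero
        have hdiv : a / ω ^ τ < ω := by rwa [← lt_mul_iff_div_lt hτ, ← opow_succ]
        obtain ⟨M, hM⟩ := lt_omega0.1 hdiv
        obtain ⟨N, hN⟩ := exists_nat_ge (2 * M * C / ε)
        refine ⟨M, N + 1, ω ^ τ * (N + 1 : ℕ),
          opow_mul_lt_opow (natCast_lt_omega0 _) (Order.lt_succ τ), ?_, ?_⟩
        · rw [div_le_iff₀ hε] at hN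
          push_cast
          nlinarith
        · intro ξ hζξ hξ1 hξ
          have hlog : log ω ξ = τ := by
            refine (log_eq_iff one_lt_omega0 (Order.one_le_iff_pos.1 hξ1).ne' τ).2 ⟨?_, hξ⟩
            simpa using (omega0_opow_le_mul_natCast_add (by omega : 1 ≤ N + 1) τ 0).trans
              (by simpa using hζξ)
          rw [hlog]
          exact ⟨a % ω ^ τ, mod_lt _ hτ, by rw [← hM, div_add_mod], hζξ⟩
      · refine ⟨0, 0, ω ^ Order.succ (log ω a), ?_, by simp, ?_⟩
        · rw [opow_lt_opow_iff_right one_lt_omega0]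
          refine lt_of_le_of_ne (Order.succ_le_of_lt ?_) fun h => hsucc ⟨_, h.symm⟩
          exact lt_log_of_lt_opow hσ ha
        · intro ξ hζξ hξ1 hξ
          refine ⟨a, ?_, by simp, by simp⟩
          refine (lt_opow_succ_log_self one_lt_omega0 a).trans_le ?_
          gcongr
          · exact omega0_pos
          · exact le_log_of_opow_le one_lt_omega0 hζξ
    refine ⟨ζ, hζ, fun ξ hζξ hξ1 hξ => ?_⟩
    obtain ⟨a', ha', haeq, hN⟩ := hdec.2 ξ hζξ hξ1 hξ
    have hξ0 := (Order.one_le_iff_pos.1 hξ1).ne'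
    obtain ⟨n, ρ, hn, hρ, hξeq⟩ := exists_eq_omega0_opow_log_mul_add hξ0
    have hlog : log ω ξ < σ := (lt_opow_iff_log_lt one_lt_omega0 hξ0).1 hξ
    generalize log ω ξ = τ at *
    have hNn : N ≤ n := by
      by_contra! h
      have := mul_natCast_add_lt h hρ
      rw [← hξeq] at this
      exact this.not_ge hN
    subst hξeq haeq
    refine (abs_upperMean_concatSeq_sub_le (ih τ hlog) hn hρ ha' hr
      fun η hη => hs η (hη.trans hξ)).trans ?_
    rw [div_le_iff₀ (by exact_mod_cast hn)]
    refine hdec.1.trans ?_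
    gcongr
  rw [upperMean_omega0_opow hσ, upperMean_omega0_opow hσ]
  refine le_antisymm
    (iInf_iSup_Ico_le_of_eventually_le (g := fun ξ => upperMean ξ (concatSeq a r s))
      (h := fun ξ => upperMean ξ s) h1 (hb _ hc) (hb _ hs) fun ε hε => ?_)
    (iInf_iSup_Ico_le_of_eventually_le (g := fun ξ => upperMean ξ s)
      (h := fun ξ => upperMean ξ (concatSeq a r s)) h1 (hb _ hs) (hb _ hc) fun ε hε => ?_) <;>
  · obtain ⟨ζ, hζ, H⟩ := key ε hε
    refine ⟨ζ, hζ, fun ξ h h' h'' => ?_⟩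
    have := abs_le.1 (H ξ h h' h'')
    linarith

theorem concatN_blocks (β : Ordinal.{0}) {n : ℕ} (hn : 1 ≤ n) (g : Ordinal.{0} → ℝ) :
    concatN β n (fun i ξ => g (β * (i : ℕ) + ξ)) = g := by
  induction n, hn using Nat.le_induction with
  | base =>
    funext ξ
    simp [concatN, concatSeq]
  | succ n hn ih =>
    funext ξ
    simp only [concatN, concatSeq, Fin.val_castSucc, Fin.val_last, ih]
    split_ifs with h
    · rfl
    · rw [Ordinal.add_sub_cancel_of_le (not_lt.1 h)]

theorem concatSeq_self_add (b : Ordinal.{0}) (f : Ordinal.{0} → ℝ) :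
    concatSeq b f (fun ξ => f (b + ξ)) = f := by
  funext ξ
  rw [concatSeq]
  split_ifs with h
  · rfl
  · rw [Ordinal.add_sub_cancel_of_le (not_lt.1 h)]

/-- axiomatic characterization of the upper mean.  Any real-valued
function `F` on (length, sequence) pairs satisfying:
(1) `F(s) = s₀` for length-one sequences;
(2) `F(s ⊕ r) = F(r ⊕ s)` for bounded sequences of nonzero lengths;
(3) `F(s₀ ⊕ ⋯ ⊕ s_{n-1}) = (1/n)(F(s₀) + ⋯ + F(s_{n-1}))` for bounded sequences
    of equal nonzero length;
(4) `F(s) = limsup_{ξ → ℓ(s)} F(s|_ξ)` for indecomposable length `> 1`;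
agrees with `M̄` on every bounded sequence of nonzero length. -/
theorem upperMean_unique (F : Ordinal.{0} → (Ordinal.{0} → ℝ) → ℝ)
    (h1 : ∀ f : Ordinal.{0} → ℝ, F 1 f = f 0)
    (h2 : ∀ a b : Ordinal.{0}, a ≠ 0 → b ≠ 0 → ∀ r s : Ordinal.{0} → ℝ,
      SeqBounded a r → SeqBounded b s →
      F (b + a) (concatSeq b s r) = F (a + b) (concatSeq a r s))
    (h3 : ∀ n : ℕ, 1 ≤ n → ∀ β : Ordinal.{0}, β ≠ 0 →
      ∀ s : Fin n → Ordinal.{0} → ℝ, (∀ i, SeqBounded β (s i)) →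
      F (β * n) (concatN β n s) = (n : ℝ)⁻¹ * ∑ i, F β (s i))
    (h4 : ∀ o : Ordinal.{0}, 1 < o → IsIndecomposable o →
      ∀ f : Ordinal.{0} → ℝ, SeqBounded o f →
      F o f = ⨅ ζ : Set.Ico (1 : Ordinal.{0}) o, ⨆ ξ : Set.Ico ζ.1 o, F ξ.1 f) :
    ∀ o : Ordinal.{0}, o ≠ 0 → ∀ f : Ordinal.{0} → ℝ, SeqBounded o f →
      F o f = upperMean o f := by
  intro o
  induction o using WellFoundedLT.induction with
  | ind o ih =>
  intro ho f hf
  obtain ⟨n, ρ, hn, hρ, hoeq⟩ := exists_eq_omega0_opow_log_mul_add ho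
  generalize log ω o = τ at hρ hoeq
  have hle := omega0_opow_le_mul_natCast_add hn τ ρ
  have hne : ω ^ τ ≠ 0 := opow_ne_zero _ omega0_ne_zero
  have hpow : ∀ g, SeqBounded (ω ^ τ) g → F (ω ^ τ) g = upperMean (ω ^ τ) g := by
    intro g hg
    obtain rfl | hτ := eq_or_ne τ 0
    · rw [opow_zero, h1, upperMean_one]
    · rw [h4 _ (one_lt_omega0_opow hτ) (isIndecomposable_omega0_opow τ) g hg,
        upperMean_omega0_opow hτ]
      obtain ⟨C, hC⟩ := hg
      refine iInf_congr fun ζ => iSup_congr fun ξ => ?_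
      exact ih ξ.1 (ξ.2.2.trans_le (hoeq ▸ hle))
        (Order.one_le_iff_pos.1 (ζ.2.1.trans ξ.2.1)).ne' g ⟨C, fun η hη => hC η (hη.trans ξ.2.2)⟩
  have hblocks : ∀ g, SeqBounded (ω ^ τ * n) g →
      F (ω ^ τ * n) g =
        (n : ℝ)⁻¹ * ∑ i ∈ Finset.range n, upperMean (ω ^ τ) (fun ξ => g (ω ^ τ * i + ξ)) := by
    rintro g ⟨C, hC⟩
    have hb : ∀ i : Fin n, SeqBounded (ω ^ τ) fun ξ => g (ω ^ τ * (i : ℕ) + ξ) := fun i =>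
      ⟨C, fun ξ hξ => hC _ (mul_natCast_add_lt i.2 hξ)⟩
    have h := h3 n hn (ω ^ τ) hne (fun i ξ => g (ω ^ τ * (i : ℕ) + ξ)) hb
    rw [concatN_blocks _ hn] at h
    rw [h, Finset.sum_range]
    congr 1
    exact Finset.sum_congr rfl fun i _ => hpow _ (hb i)
  obtain ⟨C, hC⟩ := hf
  subst hoeq
  rw [upperMean_mul_natCast_add hn hρ]
  obtain rfl | hρ0 := eq_or_ne ρ 0
  · rw [add_zero] at hC ⊢
    exact hblocks f ⟨C, hC⟩
  have hn' : ω ^ τ ≤ ω ^ τ * n := by simpa using omega0_opow_le_mul_natCast_add hn τ 0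
  have hCn : ∀ ξ < ω ^ τ * n, |f ξ| ≤ C := fun ξ hξ => hC ξ (hξ.trans_le le_self_add)
  have hCρ : ∀ ξ < ρ, |f (ω ^ τ * n + ξ)| ≤ C := fun ξ hξ => hC _ (by gcongr)
  have hswap := h2 ρ (ω ^ τ * n) hρ0 ((pos_iff_ne_zero.2 hne).trans_le hn').ne'
    (fun ξ => f (ω ^ τ * n + ξ)) f ⟨C, hCρ⟩ ⟨C, hCn⟩
  rw [concatSeq_self_add, add_of_omega0_opow_le hρ hn',
    hblocks _ ⟨C, abs_concatSeq_le hCρ hCn⟩] at hswap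
  rw [hswap]
  congr 1
  refine Finset.sum_congr rfl fun i _ => ?_
  obtain rfl | hi := Nat.eq_zero_or_pos i
  · simp only [Nat.cast_zero, mul_zero, zero_add]
    exact upperMean_omega0_opow_concatSeq τ ρ hρ _ _ hCρ fun ξ hξ => hCn ξ (hξ.trans_le hn')
  · rw [concatSeq_omega0_opow_mul hρ hi]
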